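/- For all integers i, j with 0 ≤ i < n and 0 ≤ j < t: (1) a^{cⁱ(ba)^j c} = a^{c^{(i+1) mod n}(ba)^j}, and (2) a^{cⁱ(ba)^j bc} = a^{c^{(i-1) mod n}(ba)^j b}. (These say that in the Cayley graph of Q_{(2,n)}(L_{2t+1}), with x_{i,2j} := a^{cⁱ(ba)^j} and x_{i,2j+1} := a^{cⁱ(ba)^j b}, one has x_{i,2j}^c = x_{i+1,2j} and x_{i,2j+1}^c = x_{i-1,2j+1}, first subscripts taken modulo n.) -/

import Mathlib

/-- A quandle in the paper's (right-action) conventions: `op x y` is `x ▷ y` (written `x^y`)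
and `inv x y` is `x ▷⁻¹ y` (written `x^{ȳ}`). -/
structure LinkQuandle (Q : Type*) where
  op : Q → Q → Q
  inv : Q → Q → Q
  idem : ∀ x, op x x = x
  inv_op : ∀ x y, inv (op x y) y = x
  op_inv : ∀ x y, op (inv x y) y = x
  distrib : ∀ x y z, op (op x y) z = op (op x z) (op y z)

/-- `opPow q y n x` is `x^{yⁿ}`: act on `x` by `y`, `n` times. -/
def LinkQuandle.opPow {Q : Type*} (q : LinkQuandle Q) (y : Q) (n : ℕ) (x : Q) : Q :=
  (fun z => q.op z y)^[n] x

/-- `pairPow q y z t x` is `x^{(yz)^t}`: act on `x` by `y` then `z`, `t` times. -/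
def LinkQuandle.pairPow {Q : Type*} (q : LinkQuandle Q) (y z : Q) (t : ℕ) (x : Q) : Q :=
  (fun w => q.op (q.op w y) z)^[t] x

/-- The smallest subset of `Q` containing `S` and closed under acting (and inversely acting)
by every element of `S`. -/
def LinkQuandle.genClosure {Q : Type*} (q : LinkQuandle Q) (S : Set Q) : Set Q :=
  ⋂₀ {T : Set Q | S ⊆ T ∧ ∀ x ∈ T, ∀ s ∈ S, q.op x s ∈ T ∧ q.inv x s ∈ T}

namespace LinkQuandle

variable {Q : Type*} (q : LinkQuandle Q)

/-- The permutation `x ↦ x ▷ y`. -/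
def actPerm (y : Q) : Equiv.Perm Q where
  toFun x := q.op x y
  invFun x := q.inv x y
  left_inv x := q.inv_op x y
  right_inv x := q.op_inv x y

@[simp] theorem actPerm_apply (x y : Q) : q.actPerm y x = q.op x y := rfl

theorem opPow_eq (y : Q) (n : ℕ) (x : Q) : q.opPow y n x = (q.actPerm y ^ n) x := by
  rw [← Equiv.Perm.iterate_eq_pow]; rfl

theorem pairPow_eq (y z : Q) (n : ℕ) (x : Q) :
    q.pairPow y z n x = ((q.actPerm z * q.actPerm y) ^ n) x := by
  rw [← Equiv.Perm.iterate_eq_pow]; rfl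

theorem semiconjBy_actPerm (y z : Q) :
    SemiconjBy (q.actPerm z) (q.actPerm y) (q.actPerm (q.actPerm z y)) :=
  Equiv.ext fun x => q.distrib x y z

end LinkQuandle

theorem mul_mul_pow_comm {G : Type*} [Monoid G] (x y : G) (k : ℕ) :
    x * (y * x) ^ k = (x * y) ^ k * x :=
  (SemiconjBy.pow_right (show SemiconjBy x (y * x) (x * y) from (mul_assoc x y x).symm) k).eq

/-- If the involutions `x`, `y` satisfy that `x * y` commutes with `z` and `z * y * z * y` commutes
with `x`, then `z` commutes with its conjugate by `y`. -/
theorem commute_conj_of_commute {G : Type*} [Group G] {x y z : G} (hx : x * x = 1) (hy : y * y = 1)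
    (h : Commute (x * y) z) (h' : Commute ((z * y) * (z * y)) x) : Commute z (y * z * y) := by
  have hconj : y * z * y = x * z * x := by
    calc y * z * y = (x * x) * (y * z * y) := by rw [hx, one_mul]
      _ = x * ((x * y) * z) * y := by simp only [mul_assoc]
      _ = x * (z * (x * y)) * y := by rw [h.eq]
      _ = x * z * x * (y * y) := by simp only [mul_assoc]
      _ = x * z * x := by rw [hy, mul_one]
  have hl : (z * y) * (z * y) = z * (x * z * x) := by rw [← hconj]; simp only [mul_assoc]
  rw [hl] at h'
  rw [hconj]
  change z * (x * z * x) = x * z * x * z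
  calc z * (x * z * x) = x * (x * (z * (x * z * x))) := by rw [← mul_assoc x x, hx, one_mul]
    _ = x * (z * (x * z * x) * x) := by rw [h'.eq]
    _ = x * z * x * z * (x * x) := by simp only [mul_assoc]
    _ = x * z * x * z := by rw [hx, mul_one]

theorem conj_apply_eq_inv_apply {α : Type*} {f g h : Equiv.Perm α} {x y : α} {k : ℕ}
    (hf : f * f = 1) (hg : g * g = 1) (hgf : Commute (g * f) h) (hy : g y = y)
    (hxy : (h * g * (f * g) ^ k) x = y) (hyx : (h * (g * f) ^ k) y = x) :
    (g * h * g) x = h⁻¹ x := by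
  have hinv : (f * g) ^ k * (g * f) ^ k = 1 := by
    have : f * g = (g * f)⁻¹ := by
      rw [mul_inv_rev, inv_eq_of_mul_eq_one_left hf, inv_eq_of_mul_eq_one_left hg]
    rw [this, inv_pow, inv_mul_cancel]
  have hy' : y = ((f * g) ^ k * h⁻¹) x := by
    rw [← hyx, ← Equiv.Perm.mul_apply]
    simp only [mul_assoc, inv_mul_cancel_left, hinv, Equiv.Perm.one_apply]
  have hconj : ((g * f) ^ k * (h * g)) x = ((g * f) ^ k * (g * h⁻¹)) x := by
    calc ((g * f) ^ k * (h * g)) x = (h * g * (f * g) ^ k) x := by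
          rw [← mul_assoc, (hgf.pow_left k).eq, mul_assoc, mul_assoc, mul_mul_pow_comm]
      _ = g y := by rw [hxy, hy]
      _ = ((g * f) ^ k * (g * h⁻¹)) x := by
          rw [hy', ← Equiv.Perm.mul_apply, ← mul_assoc, mul_mul_pow_comm, mul_assoc]
  have hcancel : (h * g) x = (g * h⁻¹) x := ((g * f) ^ k).injective hconj
  rw [mul_assoc, Equiv.Perm.mul_apply, hcancel, ← Equiv.Perm.mul_apply, ← mul_assoc, hg, one_mul]

theorem stmt7 {Q : Type*} (q : LinkQuandle Q) (a b c : Q) (n t : ℕ) (hn : 2 ≤ n)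
    (h1 : q.op (q.op c a) b = c)
    (h2 : q.op (q.op (q.pairPow b a t a) b) c = b)
    (h3 : q.op (q.pairPow a b t b) c = a)
    (ha : ∀ x : Q, q.op (q.op x a) a = x)
    (hb : ∀ x : Q, q.op (q.op x b) b = x)
    (hc : ∀ x : Q, q.opPow c n x = x) :
    ∀ i j : ℕ, i < n → j < t →
      q.op (q.pairPow b a j (q.opPow c i a)) c =
        q.pairPow b a j (q.opPow c ((i + 1) % n) a) ∧
      q.op (q.op (q.pairPow b a j (q.opPow c i a)) b) c =
        q.op (q.pairPow b a j (q.opPow c ((((i : ℤ) - 1) % (n : ℤ)).toNat) a)) b := by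
  have hA : q.actPerm a * q.actPerm a = 1 := Equiv.ext ha
  have hB : q.actPerm b * q.actPerm b = 1 := Equiv.ext hb
  have hC : q.actPerm c ^ n = 1 := Equiv.ext fun x => by rw [← q.opPow_eq]; exact hc x
  have hBA : Commute (q.actPerm b * q.actPerm a) (q.actPerm c) := by
    have h := (q.semiconjBy_actPerm _ b).mul_left (q.semiconjBy_actPerm c a)
    rwa [q.actPerm_apply, q.actPerm_apply, h1] at h
  have hinv : (q.actPerm b * q.actPerm a)⁻¹ = q.actPerm a * q.actPerm b := by
    rw [mul_inv_rev, inv_eq_of_mul_eq_one_left hA, inv_eq_of_mul_eq_one_left hB]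
  have hAB : Commute (q.actPerm a * q.actPerm b) (q.actPerm c) := hinv ▸ hBA.inv_left
  have hconj : (q.actPerm b * q.actPerm c * q.actPerm b) a = (q.actPerm c)⁻¹ a := by
    refine conj_apply_eq_inv_apply (k := t) hA hB hBA (q.idem b) ?_ ?_
    · rwa [q.pairPow_eq] at h2
    · rwa [q.pairPow_eq] at h3
  have hfix : ((q.actPerm c * q.actPerm b) * (q.actPerm c * q.actPerm b)) a = a := by
    calc ((q.actPerm c * q.actPerm b) * (q.actPerm c * q.actPerm b)) a
        = q.actPerm c ((q.actPerm b * q.actPerm c * q.actPerm b) a) := rfl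
      _ = a := by rw [hconj, ← Equiv.Perm.mul_apply, mul_inv_cancel, Equiv.Perm.one_apply]
  have hfixcomm : Commute ((q.actPerm c * q.actPerm b) * (q.actPerm c * q.actPerm b))
      (q.actPerm a) := by
    have hcb (y : Q) := (q.semiconjBy_actPerm _ c).mul_left (q.semiconjBy_actPerm y b)
    have h := (hcb _).mul_left (hcb a)
    simp only [Equiv.Perm.mul_apply] at h hfix
    rwa [hfix] at h
  have hcomm := commute_conj_of_commute hA hB hAB hfixcomm
  intro i j _ _
  simp only [q.pairPow_eq, q.opPow_eq, ← q.actPerm_apply, ← Equiv.Perm.mul_apply]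
  generalize q.actPerm a = A at *
  generalize q.actPerm b = B at *
  generalize q.actPerm c = C at *
  constructor
  · rw [← pow_eq_pow_mod _ hC, pow_succ', ← mul_assoc, ← mul_assoc, (hAB.pow_left j).eq]
  · have hm : C ^ ((((i : ℤ) - 1) % (n : ℤ)).toNat) = C ^ i * C⁻¹ := by
      rw [← zpow_natCast, Int.toNat_of_nonneg (Int.emod_nonneg _ (by omega)),
        ← zpow_eq_zpow_emod' _ hC, zpow_sub_one, zpow_natCast]
    calc (C * (B * ((A * B) ^ j * C ^ i))) a
        = ((B * A) ^ j * B * (B * C * B * C ^ i)) a := by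
          congr 1
          rw [← mul_assoc B, mul_mul_pow_comm, mul_assoc _ B, ← mul_assoc C,
            ← (hBA.pow_left j).eq]
          simp only [mul_assoc]
          rw [← mul_assoc B B, hB, one_mul]
      _ = ((B * A) ^ j * B * C ^ i) ((B * C * B) a) := by
          rw [← (hcomm.pow_left i).eq]; rfl
      _ = (B * ((A * B) ^ j * C ^ ((((i : ℤ) - 1) % (n : ℤ)).toNat))) a := by
          rw [hconj, hm, ← mul_mul_pow_comm]; rfl
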